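/- arXiv:1801.09099 — 2 statements merged into one kernel-verified Lean document; each statement's English description precedes it below -/
import Mathlib

section
/- Let a, b, c be real, let n ≥ k ≥ 0 be integers, and let (x,y) be real with x ≠ 1; write z = 1−x−y. Then: (2n+a+b+c+2)·x·P_{n,k}^{(a,b,c)}(x,y) = (n−k+a)·P_{n,k}^{(a−1,b,c)}(x,y) + (n−k+1)·P_{n+1,k}^{(a−1,b,c)}(x,y); (2k+b+c+1)(2n+a+b+c+2)·y·P_{n,k}^{(a,b,c)}(x,y) = (k+b)(n+k+b+c+1)·P_{n,k}^{(a,b−1,c)}(x,y) − (k+1)(n−k+a)·P_{n,k+1}^{(a,b−1,c)}(x,y) − (k+b)(n−k+1)·P_{n+1,k}^{(a,b−1,c)}(x,y) + (k+1)(n+k+a+b+c+2)·P_{n+1,k+1}^{(a,b−1,c)}(x,y); and (2k+b+c+1)(2n+a+b+c+2)·z·P_{n,k}^{(a,b,c)}(x,y) = (k+c)(n+k+b+c+1)·P_{n,k}^{(a,b,c−1)}(x,y) + (k+1)(n−k+a)·P_{n,k+1}^{(a,b,c−1)}(x,y) − (k+c)(n−k+1)·P_{n+1,k}^{(a,b,c−1)}(x,y)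 − (k+1)(n+k+a+b+c+2)·P_{n+1,k+1}^{(a,b,c−1)}(x,y). -/
noncomputable section

/-- Generalized binomial coefficient `C(α, j) = α(α−1)⋯(α−j+1)/j!`. -/
def genBinom (α : ℝ) (j : ℕ) : ℝ :=
  (∏ i ∈ Finset.range j, (α - i)) / (Nat.factorial j)

/-- Jacobi polynomial `P_n^{(a,b)}(x)`; zero for negative `n`. -/
def jacobiP (n : ℤ) (a b : ℝ) (x : ℝ) : ℝ :=
  if n < 0 then 0 else
    ∑ m ∈ Finset.range (n.toNat + 1),
      genBinom ((n : ℝ) + a) (n.toNat - m) * genBinom ((n : ℝ) + b) m *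
        ((x - 1) / 2) ^ m * ((x + 1) / 2) ^ (n.toNat - m)

/-- Four-parameter Koornwinder polynomial `P_{n,k}^{(a,b,c,d)}(x,y)`;
zero whenever `k < 0`, `n < 0`, or `k > n` (covering the conventions
`k = −1`, `n = −1`, `k = n+1`). -/
def koornP (n k : ℤ) (a b c d : ℝ) (x y : ℝ) : ℝ :=
  if n < 0 ∨ k < 0 ∨ n < k then 0 else
    jacobiP (n - k) (2 * (k : ℝ) + b + c + d + 1) a (2 * x - 1) *
      (1 - x) ^ k.toNat * jacobiP k c b (-1 + 2 * y / (1 - x))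

theorem genBinom_zero (α : ℝ) : genBinom α 0 = 1 := by
  simp [genBinom]

/-- Absorption identity for the generalized binomial coefficient. -/
theorem succ_mul_genBinom_succ (α : ℝ) (j : ℕ) :
    ((j : ℝ) + 1) * genBinom α (j + 1) = α * genBinom (α - 1) j := by
  have hprod : ∏ i ∈ Finset.range (j + 1), (α - (i : ℝ))
      = α * ∏ i ∈ Finset.range j, (α - 1 - (i : ℝ)) := by
    rw [Finset.prod_range_succ', mul_comm]
    congr 1
    · simp
    · refine Finset.prod_congr rfl fun i _ => ?_
      push_cast
      ring
  have hj : (j : ℝ) + 1 ≠ 0 := by positivity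
  have hf : (j.factorial : ℝ) ≠ 0 := by positivity
  rw [genBinom, genBinom, hprod, Nat.factorial_succ]
  push_cast
  field_simp

theorem succ_mul_genBinom_succ' (α : ℝ) (j : ℕ) :
    ((j : ℝ) + 1) * genBinom α (j + 1) = (α - j) * genBinom α j := by
  have hj : (j : ℝ) + 1 ≠ 0 := by positivity
  have hf : (j.factorial : ℝ) ≠ 0 := by positivity
  rw [genBinom, genBinom, Finset.prod_range_succ, Nat.factorial_succ]
  push_cast
  field_simp

/-- Pascal's rule for the generalized binomial coefficient. -/
theorem genBinom_add_one_succ (α : ℝ) (j : ℕ) :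
    genBinom (α + 1) (j + 1) = genBinom α (j + 1) + genBinom α j := by
  have hj : (j : ℝ) + 1 ≠ 0 := by positivity
  have h₁ := succ_mul_genBinom_succ (α + 1) j
  have h₂ := succ_mul_genBinom_succ' α j
  rw [add_sub_cancel_right] at h₁
  apply mul_left_cancel₀ hj
  linear_combination h₁ - h₂

/-- The `n`-th coefficient in `t` of the formal power series `(1 + u t)^β (1 + v t)^α`. -/
def binomConv (n : ℕ) (α β u v : ℝ) : ℝ :=
  ∑ p ∈ Finset.HasAntidiagonal.antidiagonal n, genBinom α p.2 * genBinom β p.1 * u ^ p.1 * v ^ p.2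

theorem binomConv_zero (α β u v : ℝ) : binomConv 0 α β u v = 1 := by
  simp [binomConv, genBinom_zero]

theorem binomConv_add_one_left (n : ℕ) (α β u v : ℝ) :
    binomConv (n + 1) (α + 1) β u v = binomConv (n + 1) α β u v + v * binomConv n α β u v := by
  simp only [binomConv, Finset.Nat.sum_antidiagonal_succ', genBinom_add_one_succ, genBinom_zero,
    Finset.mul_sum]
  rw [add_assoc, ← Finset.sum_add_distrib]
  congr 1
  refine Finset.sum_congr rfl fun p _ => ?_
  ring

theorem binomConv_add_one_right (n : ℕ) (α β u v : ℝ) :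
    binomConv (n + 1) α (β + 1) u v = binomConv (n + 1) α β u v + u * binomConv n α β u v := by
  simp only [binomConv, Finset.Nat.sum_antidiagonal_succ, genBinom_add_one_succ, genBinom_zero,
    Finset.mul_sum]
  rw [add_assoc, ← Finset.sum_add_distrib]
  congr 1
  refine Finset.sum_congr rfl fun p _ => ?_
  ring

theorem succ_mul_binomConv_succ (n : ℕ) (α β u v : ℝ) :
    ((n : ℝ) + 1) * binomConv (n + 1) α β u v
      = β * u * binomConv n α (β - 1) u v + α * v * binomConv n (α - 1) β u v := by
  have hsplit : ((n : ℝ) + 1) * binomConv (n + 1) α β u v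
      = ∑ p ∈ Finset.HasAntidiagonal.antidiagonal (n + 1),
          (p.1 : ℝ) * (genBinom α p.2 * genBinom β p.1 * u ^ p.1 * v ^ p.2)
        + ∑ p ∈ Finset.HasAntidiagonal.antidiagonal (n + 1),
          (p.2 : ℝ) * (genBinom α p.2 * genBinom β p.1 * u ^ p.1 * v ^ p.2) := by
    rw [binomConv, Finset.mul_sum, ← Finset.sum_add_distrib]
    refine Finset.sum_congr rfl fun p hp => ?_
    have hp' : (p.1 : ℝ) + p.2 = n + 1 := by
      exact_mod_cast Finset.HasAntidiagonal.mem_antidiagonal.mp hp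
    rw [← hp']
    ring
  rw [hsplit, Finset.Nat.sum_antidiagonal_succ, Finset.Nat.sum_antidiagonal_succ']
  simp only [binomConv, Finset.mul_sum, Nat.cast_zero, zero_mul, zero_add, Nat.cast_add,
    Nat.cast_one]
  congr 1 <;> refine Finset.sum_congr rfl fun p _ => ?_
  · linear_combination
      (genBinom α p.2 * u ^ (p.1 + 1) * v ^ p.2) * succ_mul_genBinom_succ β p.1
  · linear_combination
      (genBinom β p.1 * u ^ p.1 * v ^ (p.2 + 1)) * succ_mul_genBinom_succ α p.2

theorem mul_binomConv_sub_mul_binomConv (n : ℕ) (α β u v : ℝ) :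
    v * binomConv n α (β + 1) u v - u * binomConv n (α + 1) β u v
      = (v - u) * binomConv n α β u v := by
  cases n with
  | zero => simp [binomConv_zero]
  | succ n =>
    rw [binomConv_add_one_left, binomConv_add_one_right]
    ring

theorem jacobiP_of_neg {n : ℤ} (hn : n < 0) (a b x : ℝ) : jacobiP n a b x = 0 :=
  if_pos hn

theorem jacobiP_natCast (n : ℕ) (a b x : ℝ) :
    jacobiP n a b x = binomConv n (n + a) (n + b) ((x - 1) / 2) ((x + 1) / 2) := by
  rw [jacobiP, if_neg (by omega), binomConv, Finset.Nat.sum_antidiagonal_eq_sum_range_succ_mk]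
  simp

theorem jacobiP_mul_one_add {n : ℤ} (hn : 0 ≤ n) (a b x : ℝ) :
    (2 * (n : ℝ) + a + b + 1) * ((1 + x) / 2) * jacobiP n a b x
      = ((n : ℝ) + b) * jacobiP n a (b - 1) x
        + ((n : ℝ) + 1) * jacobiP (n + 1) a (b - 1) x := by
  lift n to ℕ using hn
  have h₁ := succ_mul_binomConv_succ n (n + a + 1) (n + b) ((x - 1) / 2) ((x + 1) / 2)
  have h₂ := mul_binomConv_sub_mul_binomConv n (n + a) (n + b - 1) ((x - 1) / 2) ((x + 1) / 2)
  rw [sub_add_cancel] at h₂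
  rw [add_sub_cancel_right] at h₁
  rw [← Nat.cast_succ, jacobiP_natCast, jacobiP_natCast, jacobiP_natCast]
  have e₁ : ((n.succ : ℕ) : ℝ) + a = n + a + 1 := by push_cast; ring
  have e₂ : ((n.succ : ℕ) : ℝ) + (b - 1) = n + b := by push_cast; ring
  have e₃ : (n : ℝ) + (b - 1) = n + b - 1 := by ring
  rw [e₁, e₂, e₃]
  push_cast
  linear_combination ((n : ℝ) + b) * h₂ - h₁

theorem jacobiP_mul_one_sub {n : ℤ} (hn : 0 ≤ n) (a b x : ℝ) :
    (2 * (n : ℝ) + a + b + 1) * ((1 - x) / 2) * jacobiP n a b x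
      = ((n : ℝ) + a) * jacobiP n (a - 1) b x
        - ((n : ℝ) + 1) * jacobiP (n + 1) (a - 1) b x := by
  lift n to ℕ using hn
  have h₁ := succ_mul_binomConv_succ n (n + a) (n + b + 1) ((x - 1) / 2) ((x + 1) / 2)
  have h₂ := mul_binomConv_sub_mul_binomConv n (n + a - 1) (n + b) ((x - 1) / 2) ((x + 1) / 2)
  rw [sub_add_cancel] at h₂
  rw [add_sub_cancel_right] at h₁
  rw [← Nat.cast_succ, jacobiP_natCast, jacobiP_natCast, jacobiP_natCast]
  have e₁ : ((n.succ : ℕ) : ℝ) + (a - 1) = n + a := by push_cast; ring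
  have e₂ : ((n.succ : ℕ) : ℝ) + b = n + b + 1 := by push_cast; ring
  have e₃ : (n : ℝ) + (a - 1) = n + a - 1 := by ring
  rw [e₁, e₂, e₃]
  push_cast
  linear_combination ((n : ℝ) + a) * h₂ + h₁

theorem jacobiP_raise_left {n : ℤ} (hn : 0 ≤ n) (a b x : ℝ) :
    (2 * (n : ℝ) + a + b + 1) * jacobiP n a b x
      = ((n : ℝ) + a + b + 1) * jacobiP n (a + 1) b x
        - ((n : ℝ) + b) * jacobiP (n - 1) (a + 1) b x := by
  lift n to ℕ using hn
  cases n with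
  | zero =>
    rw [jacobiP_of_neg (n := ((0 : ℕ) : ℤ) - 1) (by simp), jacobiP_natCast, jacobiP_natCast,
      binomConv_zero, binomConv_zero]
    simp
  | succ n =>
    have h₁ := succ_mul_binomConv_succ n (n + 1 + a + 1) (n + 1 + b) ((x - 1) / 2) ((x + 1) / 2)
    have h₂ := mul_binomConv_sub_mul_binomConv n (n + 1 + a) (n + 1 + b - 1)
      ((x - 1) / 2) ((x + 1) / 2)
    have h₃ := binomConv_add_one_left n (n + 1 + a) (n + 1 + b) ((x - 1) / 2) ((x + 1) / 2)
    rw [sub_add_cancel] at h₂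
    rw [add_sub_cancel_right] at h₁
    have e₀ : ((n + 1 : ℕ) : ℤ) - 1 = n := by push_cast; ring
    rw [e₀, jacobiP_natCast, jacobiP_natCast, jacobiP_natCast]
    have e₁ : ((n + 1 : ℕ) : ℝ) + (a + 1) = n + 1 + a + 1 := by push_cast; ring
    have e₂ : (n : ℝ) + (a + 1) = n + 1 + a := by ring
    have e₃ : (n : ℝ) + b = n + 1 + b - 1 := by ring
    rw [e₁, e₂, e₃]
    push_cast
    linear_combination h₁ - ((n : ℝ) + 1 + b) * h₂ - ((n : ℝ) + a + b + 1 + n + 2) * h₃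

/-- The defining formula of `koornP` also holds when `k > n`, where both sides vanish. -/
theorem koornP_eq {n k : ℤ} (hn : 0 ≤ n) (hk : 0 ≤ k) (a b c d x y : ℝ) :
    koornP n k a b c d x y
      = jacobiP (n - k) (2 * (k : ℝ) + b + c + d + 1) a (2 * x - 1) *
        (1 - x) ^ k.toNat * jacobiP k c b (-1 + 2 * y / (1 - x)) := by
  rw [koornP]
  split_ifs with h
  · rw [jacobiP_of_neg (n := n - k) (by omega), zero_mul, zero_mul]
  · rfl

theorem koorn_multiplication (a b c : ℝ) (n k : ℤ) (hk : 0 ≤ k) (hnk : k ≤ n)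
    (x y : ℝ) (hx : x ≠ 1) :
    ((2 * (n : ℝ) + a + b + c + 2) * x * koornP n k a b c 0 x y
      = ((n : ℝ) - (k : ℝ) + a) * koornP n k (a - 1) b c 0 x y
        + ((n : ℝ) - (k : ℝ) + 1) * koornP (n + 1) k (a - 1) b c 0 x y) ∧
    ((2 * (k : ℝ) + b + c + 1) * (2 * (n : ℝ) + a + b + c + 2) * y
          * koornP n k a b c 0 x y
      = ((k : ℝ) + b) * ((n : ℝ) + (k : ℝ) + b + c + 1)
            * koornP n k a (b - 1) c 0 x y
        - ((k : ℝ) + 1) * ((n : ℝ) - (k : ℝ) + a)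
            * koornP n (k + 1) a (b - 1) c 0 x y
        - ((k : ℝ) + b) * ((n : ℝ) - (k : ℝ) + 1)
            * koornP (n + 1) k a (b - 1) c 0 x y
        + ((k : ℝ) + 1) * ((n : ℝ) + (k : ℝ) + a + b + c + 2)
            * koornP (n + 1) (k + 1) a (b - 1) c 0 x y) ∧
    ((2 * (k : ℝ) + b + c + 1) * (2 * (n : ℝ) + a + b + c + 2) * (1 - x - y)
          * koornP n k a b c 0 x y
      = ((k : ℝ) + c) * ((n : ℝ) + (k : ℝ) + b + c + 1)
            * koornP n k a b (c - 1) 0 x y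
        + ((k : ℝ) + 1) * ((n : ℝ) - (k : ℝ) + a)
            * koornP n (k + 1) a b (c - 1) 0 x y
        - ((k : ℝ) + c) * ((n : ℝ) - (k : ℝ) + 1)
            * koornP (n + 1) k a b (c - 1) 0 x y
        - ((k : ℝ) + 1) * ((n : ℝ) + (k : ℝ) + a + b + c + 2)
            * koornP (n + 1) (k + 1) a b (c - 1) 0 x y) := by
  have hN : 0 ≤ n - k := by omega
  have hx' : 1 - x ≠ 0 := sub_ne_zero.mpr hx.symm
  rw [koornP_eq (by omega) hk, koornP_eq (by omega) hk, koornP_eq (by omega) hk,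
    koornP_eq (by omega) hk, koornP_eq (by omega) (by omega), koornP_eq (by omega) hk,
    koornP_eq (by omega) (by omega), koornP_eq (by omega) hk, koornP_eq (by omega) (by omega),
    koornP_eq (by omega) hk, koornP_eq (by omega) (by omega)]
  have ht : (k + 1).toNat = k.toNat + 1 := by omega
  have i₁ : n + 1 - k = n - k + 1 := by ring
  have i₂ : n - (k + 1) = n - k - 1 := by ring
  have i₃ : n + 1 - (k + 1) = n - k := by ring
  have p₁ : 2 * ((k + 1 : ℤ) : ℝ) + (b - 1) + c + 0 + 1 = 2 * (k : ℝ) + b + c + 0 + 1 + 1 := by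
    push_cast; ring
  have p₂ : 2 * ((k + 1 : ℤ) : ℝ) + b + (c - 1) + 0 + 1 = 2 * (k : ℝ) + b + c + 0 + 1 + 1 := by
    push_cast; ring
  have p₃ : 2 * (k : ℝ) + (b - 1) + c + 0 + 1 = 2 * (k : ℝ) + b + c + 0 + 1 - 1 := by ring
  have p₄ : 2 * (k : ℝ) + b + (c - 1) + 0 + 1 = 2 * (k : ℝ) + b + c + 0 + 1 - 1 := by ring
  rw [ht, i₁, i₂, i₃, p₁, p₂, p₃, p₄, pow_succ]
  set A := 2 * (k : ℝ) + b + c + 0 + 1 with hA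
  set s := -1 + 2 * y / (1 - x) with hs
  have hy : y = (1 - x) * ((1 + s) / 2) := by rw [hs]; field_simp; ring
  have hz : 1 - x - y = (1 - x) * ((1 - s) / 2) := by rw [hy]; ring
  have hplus := jacobiP_mul_one_add hN A a (2 * x - 1)
  have hminus := jacobiP_mul_one_sub hN A a (2 * x - 1)
  have hraise := jacobiP_raise_left hN A a (2 * x - 1)
  have kplus := jacobiP_mul_one_add hk c b s
  have kminus := jacobiP_mul_one_sub hk c b s
  push_cast at hplus hminus hraise
  rw [hz, hy]
  clear_value s
  set E := (1 - x) ^ k.toNat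
  refine ⟨?_, ?_, ?_⟩
  · linear_combination (E * jacobiP k c b s) * hplus
  · linear_combination
      ((2 * (n : ℝ) + a + b + c + 2) * (1 - x) * E * jacobiP (n - k) A a (2 * x - 1)) * kplus
      + (((k : ℝ) + b) * E * jacobiP k c (b - 1) s) * hminus
      + (((k : ℝ) + 1) * E * (1 - x) * jacobiP (k + 1) c (b - 1) s) * hraise
  · linear_combination
      ((2 * (n : ℝ) + a + b + c + 2) * (1 - x) * E * jacobiP (n - k) A a (2 * x - 1)) * kminus
      + (((k : ℝ) + c) * E * jacobiP k (c - 1) b s) * hminus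
      - (((k : ℝ) + 1) * E * (1 - x) * jacobiP (k + 1) (c - 1) b s) * hraise
end
end

section
/- Let a, b, c be real, let n ≥ k ≥ 0 be integers, and let (x,y) be real with x ≠ 1; write u(x,y) = P_{n,k}^{(a,b,c)}(x,y) and z = 1−x−y. Then u satisfies the two second-order differential equations: zy·∂²u/∂y² + ((1+b)(1−x) − (2+b+c)y)·∂u/∂y = −k(k+b+c+1)·u, and x(1−x)·∂²u/∂x² − 2xy·∂²u/∂x∂y + y(1−y)·∂²u/∂y² + (a+1 − (a+b+c+3)x)·∂u/∂x + (b+1 − (a+b+c+3)y)·∂u/∂y = −n(n+a+b+c+2)·u. -/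
noncomputable section

open Polynomial

theorem genBinom_succ_mul (α : ℝ) (j : ℕ) :
    genBinom α (j + 1) * (j + 1) = genBinom α j * (α - j) := by
  have h1 : (j.factorial : ℝ) ≠ 0 := by exact_mod_cast j.factorial_ne_zero
  have h2 : (j : ℝ) + 1 ≠ 0 := by positivity
  simp only [genBinom, Finset.prod_range_succ, Nat.factorial_succ]
  push_cast
  field_simp

/-- The Jacobi polynomial of degree `n` as a formal polynomial in `s = (x - 1) / 2`. -/
def jacobiShifted (n : ℕ) (a b : ℝ) : ℝ[X] :=
  ∑ m ∈ Finset.range (n + 1),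
    C (genBinom (n + a) (n - m) * genBinom (n + b) m) * (X ^ m * (X + 1) ^ (n - m))

theorem jacobiP_eq_eval_jacobiShifted (n : ℕ) (a b x : ℝ) :
    jacobiP n a b x = (jacobiShifted n a b).eval ((x - 1) / 2) := by
  have h : (x - 1) / 2 + 1 = (x + 1) / 2 := by ring
  simp [jacobiP, jacobiShifted, eval_finsetSum, h, mul_assoc]

/-- The hypergeometric operator `s (s + 1) D² + ((a + 1) (s + 1) + (b + 1) s) D - e`. -/
def hypergeomOp (a b e : ℝ) (p : ℝ[X]) : ℝ[X] :=
  X * (X + 1) * derivative (derivative p)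
    + (C (a + 1) * (X + 1) + C (b + 1) * X) * derivative p - C e * p

theorem hypergeomOp_sum (a b e : ℝ) (f : ℕ → ℝ[X]) (M : ℕ) :
    hypergeomOp a b e (∑ m ∈ Finset.range M, f m)
      = ∑ m ∈ Finset.range M, hypergeomOp a b e (f m) := by
  simp only [hypergeomOp, derivative_sum, Finset.mul_sum, Finset.sum_add_distrib,
    Finset.sum_sub_distrib]

theorem hypergeomOp_monomial (a b c : ℝ) (m j : ℕ) :
    hypergeomOp a b ((m + j : ℝ) * (m + j + a + b + 1)) (C c * (X ^ m * (X + 1) ^ j))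
      = C (c * (m * (m + a))) * (X ^ (m - 1) * (X + 1) ^ j)
        - C (c * (j * (j + b))) * (X ^ m * (X + 1) ^ (j - 1)) := by
  rcases m with _ | _ | m <;> rcases j with _ | _ | j <;>
    simp [hypergeomOp, derivative_pow] <;> ring

theorem hypergeomOp_jacobiShifted (n : ℕ) (a b : ℝ) :
    hypergeomOp a b (n * (n + a + b + 1)) (jacobiShifted n a b) = 0 := by
  have key : ∀ M ≤ n, ∑ m ∈ Finset.range M, hypergeomOp a b (n * (n + a + b + 1))
      (C (genBinom (n + a) (n - m) * genBinom (n + b) m) * (X ^ m * (X + 1) ^ (n - m)))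
      = - (C (genBinom (n + a) (n - M) * genBinom (n + b) M * (M * (M + a)))
        * (X ^ (M - 1) * (X + 1) ^ (n - M))) := by
    intro M
    induction M with
    | zero => simp
    | succ M ih =>
      intro hM
      obtain ⟨j, rfl⟩ : ∃ j, n = M + (j + 1) := ⟨n - M - 1, by omega⟩
      have h1 := hypergeomOp_monomial a b
        (genBinom ((M + (j + 1) : ℕ) + a) (j + 1) * genBinom ((M + (j + 1) : ℕ) + b) M) M (j + 1)
      rw [← Nat.cast_add] at h1
      have h2 := genBinom_succ_mul ((M + (j + 1) : ℕ) + a) j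
      have h3 := genBinom_succ_mul ((M + (j + 1) : ℕ) + b) M
      have e1 : M + (j + 1) - M = j + 1 := by omega
      have e2 : M + (j + 1) - (M + 1) = j := by omega
      rw [Finset.sum_range_succ, ih (by omega), e1, e2, h1]
      have h4 : genBinom ((M + (j + 1) : ℕ) + a) (j + 1) * genBinom ((M + (j + 1) : ℕ) + b) M
            * ((j + 1 : ℕ) * ((j + 1 : ℕ) + b))
          = genBinom ((M + (j + 1) : ℕ) + a) j * genBinom ((M + (j + 1) : ℕ) + b) (M + 1)
            * ((M + 1 : ℕ) * ((M + 1 : ℕ) + a)) := by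
        push_cast at h2 h3 ⊢
        linear_combination (genBinom (M + (j + 1) + b) M * (j + 1 + b)) * h2
          - (genBinom (M + (j + 1) + a) j * (M + 1 + a)) * h3
      rw [h4, Nat.add_sub_cancel, Nat.add_sub_cancel]
      ring
  rw [jacobiShifted, hypergeomOp_sum, Finset.sum_range_succ, key n le_rfl]
  have h := hypergeomOp_monomial a b (genBinom (n + a) 0 * genBinom (n + b) n) n 0
  simp only [Nat.cast_zero, add_zero] at h
  rw [Nat.sub_self, h]
  simp

/-- The Jacobi functions are polynomial and satisfy the Jacobi differential equation. -/
theorem exists_polynomial_eq_jacobiP (n : ℕ) (a b : ℝ) :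
    ∃ p : ℝ[X], (∀ t, jacobiP n a b t = p.eval t) ∧
      ∀ t, (1 - t ^ 2) * (derivative (derivative p)).eval t
        + (b - a - (a + b + 2) * t) * (derivative p).eval t
        + n * (n + a + b + 1) * p.eval t = 0 := by
  refine ⟨(jacobiShifted n a b).comp (C (1 / 2) * (X - 1)), fun t => ?_, fun t => ?_⟩
  · rw [jacobiP_eq_eval_jacobiShifted, eval_comp]
    congr 1
    simp
    ring
  · have h := congrArg (eval ((1 / 2) * (t - 1))) (hypergeomOp_jacobiShifted n a b)
    simp only [hypergeomOp, eval_add, eval_sub, eval_mul, eval_X, eval_C, eval_one,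
      eval_zero] at h
    simp only [derivative_comp, derivative_mul, derivative_C, derivative_sub, derivative_X,
      derivative_one, derivative_add, derivative_zero, eval_comp, eval_add, eval_sub, eval_mul,
      eval_X, eval_C, eval_one, eval_zero]
    linear_combination -h

/-- Products `q(2x - 1) (1 - x)^e p(-1 + 2y / (1 - x))`, a family closed under differentiation. -/
def triangleProd (q p : ℝ[X]) (e : ℤ) (x y : ℝ) : ℝ :=
  q.eval (2 * x - 1) * (1 - x) ^ e * p.eval (-1 + 2 * y / (1 - x))

theorem hasDerivAt_triangleProd_snd (q p : ℝ[X]) (e : ℤ) {x : ℝ} (hx : x ≠ 1) (y : ℝ) :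
    HasDerivAt (triangleProd q p e x) (2 * triangleProd q (derivative p) (e - 1) x y) y := by
  have hw : 1 - x ≠ 0 := sub_ne_zero.mpr hx.symm
  have h1 : HasDerivAt (fun y : ℝ => -1 + 2 * y / (1 - x)) (2 / (1 - x)) y := by
    simpa using (((hasDerivAt_id y).const_mul 2).div_const (1 - x)).const_add (-1)
  have h2 := ((p.hasDerivAt (-1 + 2 * y / (1 - x))).comp y h1).const_mul
    (q.eval (2 * x - 1) * (1 - x) ^ e)
  refine h2.congr_deriv ?_
  rw [triangleProd, zpow_sub_one₀ hw]
  ring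

theorem hasDerivAt_triangleProd_fst (q p : ℝ[X]) (e : ℤ) {x : ℝ} (hx : x ≠ 1) (y : ℝ) :
    HasDerivAt (fun x => triangleProd q p e x y)
      (2 * triangleProd (derivative q) p e x y - e * triangleProd q p (e - 1) x y
        + 2 * y * triangleProd q (derivative p) (e - 2) x y) x := by
  have hw : 1 - x ≠ 0 := sub_ne_zero.mpr hx.symm
  have h0 : HasDerivAt (fun x : ℝ => 1 - x) (-1) x := (hasDerivAt_id x).const_sub 1
  have h1 : HasDerivAt (fun x : ℝ => 2 * x - 1) 2 x := by
    simpa using ((hasDerivAt_id x).const_mul 2).sub_const 1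
  have h2 : HasDerivAt (fun x : ℝ => -1 + 2 * y / (1 - x)) (2 * y / (1 - x) ^ 2) x := by
    simpa using ((hasDerivAt_const x (2 * y)).div h0 hw).const_add (-1)
  have h3 := (hasDerivAt_zpow e (1 - x) (Or.inl hw)).comp x h0
  have h4 := (((q.hasDerivAt _).comp x h1).mul h3).mul ((p.hasDerivAt _).comp x h2)
  refine h4.congr_deriv ?_
  simp only [triangleProd, zpow_sub₀ hw, zpow_one, Function.comp_apply, Pi.mul_apply]
  field_simp
  ring

theorem koornP_eq_triangleProd {k N : ℕ} {a b c : ℝ} {q p : ℝ[X]}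
    (hq : ∀ t, jacobiP N (2 * k + b + c + 1) a t = q.eval t)
    (hp : ∀ t, jacobiP k c b t = p.eval t) :
    koornP (k + N : ℕ) k a b c 0 = triangleProd q p k := by
  have h1 : ¬ (((k + N : ℕ) : ℤ) < 0 ∨ (k : ℤ) < 0 ∨ ((k + N : ℕ) : ℤ) < k) := by omega
  have h2 : ((k + N : ℕ) : ℤ) - k = N := by omega
  funext x y
  rw [koornP, if_neg h1, h2]
  simp [triangleProd, hq, hp]

theorem koorn_differential_eigenproblems (a b c : ℝ) (n k : ℤ) (hk : 0 ≤ k)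
    (hnk : k ≤ n) (x y : ℝ) (hx : x ≠ 1) :
    ((1 - x - y) * y * deriv (deriv (koornP n k a b c 0 x)) y
        + ((1 + b) * (1 - x) - (2 + b + c) * y) * deriv (koornP n k a b c 0 x) y
      = -((k : ℝ) * ((k : ℝ) + b + c + 1)) * koornP n k a b c 0 x y) ∧
    (x * (1 - x) * deriv (fun x' => deriv (fun x'' => koornP n k a b c 0 x'' y) x') x
        - 2 * x * y * deriv (fun x' => deriv (koornP n k a b c 0 x') y) x
        + y * (1 - y) * deriv (deriv (koornP n k a b c 0 x)) y
        + (a + 1 - (a + b + c + 3) * x) * deriv (fun x' => koornP n k a b c 0 x' y) x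
        + (b + 1 - (a + b + c + 3) * y) * deriv (koornP n k a b c 0 x) y
      = -((n : ℝ) * ((n : ℝ) + a + b + c + 2)) * koornP n k a b c 0 x y) := by
  obtain ⟨k, rfl⟩ := Int.eq_ofNat_of_zero_le hk
  obtain ⟨N, rfl⟩ : ∃ N : ℕ, n = (k + N : ℕ) := ⟨(n - k).toNat, by omega⟩
  obtain ⟨q, hq, hq2⟩ := exists_polynomial_eq_jacobiP N (2 * k + b + c + 1) a
  obtain ⟨p, hp, hp2⟩ := exists_polynomial_eq_jacobiP k c b
  have hw : 1 - x ≠ 0 := sub_ne_zero.mpr hx.symm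
  have hy (q p : ℝ[X]) (e : ℤ) {x : ℝ} (hx : x ≠ 1) : deriv (triangleProd q p e x)
      = fun y => 2 * triangleProd q (derivative p) (e - 1) x y :=
    funext fun y => (hasDerivAt_triangleProd_snd q p e hx y).deriv
  have hyy : deriv (deriv (triangleProd q p k x)) y
      = 2 * (2 * triangleProd q (derivative (derivative p)) (k - 1 - 1) x y) := by
    rw [hy q p k hx]
    exact ((hasDerivAt_triangleProd_snd _ _ _ hx y).const_mul 2).deriv
  have hnear : ∀ᶠ x' in nhds x, x' ≠ 1 := isOpen_ne.mem_nhds hx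
  have hxy : deriv (fun x' => deriv (triangleProd q p k x') y) x = _ :=
    (((hasDerivAt_triangleProd_fst q (derivative p) (k - 1) hx y).const_mul 2).congr_of_eventuallyEq
      (hnear.mono fun x' hx' => congrFun (hy q p k hx') y)).deriv
  have hxx : deriv (fun x' => deriv (fun x'' => triangleProd q p k x'' y) x') x = _ :=
    (((((hasDerivAt_triangleProd_fst (derivative q) p k hx y).const_mul 2).sub
      ((hasDerivAt_triangleProd_fst q p (k - 1) hx y).const_mul ((k : ℤ) : ℝ))).add
      ((hasDerivAt_triangleProd_fst q (derivative p) (k - 2) hx y).const_mul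
        (2 * y))).congr_of_eventuallyEq
      (hnear.mono fun x' hx' => (hasDerivAt_triangleProd_fst q p k hx' y).deriv)).deriv
  have hq3 := hq2 (2 * x - 1)
  have hp3 := hp2 (-1 + 2 * y / (1 - x))
  rw [koornP_eq_triangleProd hq hp, hyy, hxy, hxx, (hasDerivAt_triangleProd_fst q p k hx y).deriv,
    hy q p k hx]
  simp only [triangleProd, zpow_sub₀ hw, zpow_one, zpow_natCast]
  push_cast
  generalize (1 - x) ^ k = W
  generalize eval (-1 + 2 * y / (1 - x)) p = P₀ at *
  generalize eval (-1 + 2 * y / (1 - x)) (derivative p) = P₁ at *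
  generalize eval (-1 + 2 * y / (1 - x)) (derivative (derivative p)) = P₂ at *
  generalize eval (2 * x - 1) q = Q₀ at *
  generalize eval (2 * x - 1) (derivative q) = Q₁ at *
  generalize eval (2 * x - 1) (derivative (derivative q)) = Q₂ at *
  obtain ⟨w, rfl⟩ : ∃ w, x = 1 - w := ⟨1 - x, by ring⟩
  simp only [sub_sub_cancel] at *
  constructor
  · linear_combination (norm := (field_simp; ring)) Q₀ * W * hp3
  · linear_combination (norm := (field_simp; ring)) W * P₀ * hq3 + Q₀ * W / w * hp3
end
end
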